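/- Under matched conditional-prior proposals, the Metropolis–Hastings acceptance ratio for the reward-tilted target reduces to a pure reward comparison: for any cut c ∈ Fin (L+1) and y, y' ∈ Y that agree below c, min(1, (π_β(y')·Q_c(y ∣ y')) / (π_β(y)·Q_c(y' ∣ y))) = min(1, exp(β·(S(y') − S(y)))). -/

import Mathlib

open Finset

/-- `y` and `y'` agree below the cut position `c`. -/
def agreeBelow {T : Type*} (L : ℕ) (c : Fin (L + 1)) (y y' : Fin L → T) : Prop :=
  ∀ i : Fin L, (i : ℕ) < (c : ℕ) → y i = y' i

instance {T : Type*} [DecidableEq T] (L : ℕ) (c : Fin (L + 1)) (y y' : Fin L → T) :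
    Decidable (agreeBelow L c y y') := by
  unfold agreeBelow; infer_instance

/-- Prefix marginal `m_c(y) = Σ_{z agreeing with y below c} p(z)`. -/
noncomputable def prefixMarginal {T : Type*} [Fintype T] [DecidableEq T] (L : ℕ)
    (p : (Fin L → T) → ℝ) (c : Fin (L + 1)) (y : Fin L → T) : ℝ :=
  ∑ z : Fin L → T, if agreeBelow L c y z then p z else 0

/-- Suffix-regeneration proposal `Q_c(y' ∣ y)`:  `Qc L p c y y'` is the probability of
proposing `y'` from current state `y` with cut `c`. -/
noncomputable def Qc {T : Type*} [Fintype T] [DecidableEq T] (L : ℕ)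
    (p : (Fin L → T) → ℝ) (c : Fin (L + 1)) (y y' : Fin L → T) : ℝ :=
  if agreeBelow L c y y' then p y' / prefixMarginal L p c y else 0

/-- Partition function `Z_β = Σ_y p(y) · exp(β · S(y))`. -/
noncomputable def Zbeta {Y : Type*} [Fintype Y] (p : Y → ℝ) (S : Y → ℝ) (β : ℝ) : ℝ :=
  ∑ y, p y * Real.exp (β * S y)

/-- Reward-tilted distribution `π_β(y) = p(y) · exp(β · S(y)) / Z_β`. -/
noncomputable def piBeta {Y : Type*} [Fintype Y] (p : Y → ℝ) (S : Y → ℝ) (β : ℝ) (y : Y) : ℝ :=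
  p y * Real.exp (β * S y) / Zbeta p S β

theorem agreeBelow.refl {T : Type*} {L : ℕ} (c : Fin (L + 1)) (y : Fin L → T) :
    agreeBelow L c y y :=
  fun _ _ => rfl

theorem agreeBelow.symm {T : Type*} {L : ℕ} {c : Fin (L + 1)} {y y' : Fin L → T}
    (h : agreeBelow L c y y') : agreeBelow L c y' y :=
  fun i hi => (h i hi).symm

theorem agreeBelow.trans {T : Type*} {L : ℕ} {c : Fin (L + 1)} {x y z : Fin L → T}
    (h₁ : agreeBelow L c x y) (h₂ : agreeBelow L c y z) : agreeBelow L c x z :=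
  fun i hi => (h₁ i hi).trans (h₂ i hi)

theorem prefixMarginal_congr {T : Type*} [Fintype T] [DecidableEq T] {L : ℕ}
    (p : (Fin L → T) → ℝ) {c : Fin (L + 1)} {y y' : Fin L → T} (h : agreeBelow L c y y') :
    prefixMarginal L p c y = prefixMarginal L p c y' :=
  Finset.sum_congr rfl fun _ _ => if_congr ⟨h.symm.trans, h.trans⟩ rfl rfl

theorem prefixMarginal_pos {T : Type*} [Fintype T] [DecidableEq T] {L : ℕ}
    {p : (Fin L → T) → ℝ} (hp : ∀ y, 0 < p y) (c : Fin (L + 1)) (y : Fin L → T) :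
    0 < prefixMarginal L p c y := by
  refine Finset.sum_pos' (fun z _ => ?_) ⟨y, Finset.mem_univ y, ?_⟩
  · split_ifs
    exacts [(hp z).le, le_rfl]
  · rw [if_pos (agreeBelow.refl c y)]
    exact hp y

theorem Zbeta_pos {Y : Type*} [Fintype Y] [Nonempty Y] {p : Y → ℝ} (hp : ∀ y, 0 < p y)
    (S : Y → ℝ) (β : ℝ) : 0 < Zbeta p S β :=
  Finset.sum_pos (fun y _ => mul_pos (hp y) (Real.exp_pos _)) Finset.univ_nonempty

/-- Under matched conditional-prior proposals, the Metropolis–Hastings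
acceptance ratio for the reward-tilted target reduces to a pure reward comparison. -/
theorem mh_ratio_reduces_to_reward_comparison
    {T : Type*} [Fintype T] [DecidableEq T] [Nonempty T] {L : ℕ} (hL : 0 < L)
    (p : (Fin L → T) → ℝ) (hp_pos : ∀ y, 0 < p y) (hp_sum : ∑ y, p y = 1)
    (S : (Fin L → T) → ℝ) (β : ℝ) (hβ : 0 < β)
    (c : Fin (L + 1)) (y y' : Fin L → T) (h : agreeBelow L c y y') :
    min 1 ((piBeta p S β y' * Qc L p c y' y) / (piBeta p S β y * Qc L p c y y'))
      = min 1 (Real.exp (β * (S y' - S y))) := by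
  have hm := (prefixMarginal_pos hp_pos c y').ne'
  have hZ := (Zbeta_pos hp_pos S β).ne'
  have hy := (hp_pos y).ne'
  have hy' := (hp_pos y').ne'
  congr 1
  rw [Qc, Qc, if_pos h, if_pos h.symm, prefixMarginal_congr p h, piBeta, piBeta, mul_sub,
    Real.exp_sub]
  field_simp
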